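/- Let 1/2 ≤ δ < 1 be a fixed real constant and, for each n, set k = ⌈n^{1/3}⌉. Let F = C_1 ∧ ⋯ ∧ C_{⌊δn⌋} be drawn from 𝓗₂(n,⌊δn⌋), and write F^{≤k} = C_1 ∧ ⋯ ∧ C_k and F^{>k} = C_{k+1} ∧ ⋯ ∧ C_{⌊δn⌋}. Then lim_{n→∞} Pr[θ(F^{≤k}, F^{>k}) < 2/3] = 0. -/

import Mathlib

open Finset Filter

/-- A 2-clause over variables `x_0, …, x_{n-1}`: an (ordered) pair of literals on two
distinct variables, the first literal having the smaller variable index.  A literal is a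
pair (variable, polarity).  There are `4 * (n choose 2)` such clauses. -/
abbrev Clause (n : ℕ) := {p : (Fin n × Bool) × (Fin n × Bool) // p.1.1 < p.2.1}

/-- Value of a literal under a total assignment. -/
def litVal {n : ℕ} (σ : Fin n → Bool) (ℓ : Fin n × Bool) : Bool :=
  if ℓ.2 then σ ℓ.1 else !(σ ℓ.1)

/-- A total assignment satisfies a 2-clause. -/
def clauseSat {n : ℕ} (σ : Fin n → Bool) (C : Clause n) : Prop :=
  litVal σ C.val.1 = true ∨ litVal σ C.val.2 = true

/-- Probability of the event `P` under the uniform distribution on the finite type `Ω`. -/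
noncomputable def pr (Ω : Type*) [Fintype Ω] (P : Ω → Prop) : ℝ :=
  (Nat.card {ω : Ω // P ω} : ℝ) / (Fintype.card Ω : ℝ)

/-- A partial assignment to the variables `x_0, …, x_{n-1}`. -/
abbrev PAssign (n : ℕ) := Fin n → Option Bool

/-- The (two-element) set of variables of a 2-clause. -/
def vars {n : ℕ} (C : Clause n) : Finset (Fin n) := {C.val.1.1, C.val.2.1}

/-- The set of variables assigned by a partial assignment. -/
def support {n : ℕ} (α : PAssign n) : Finset (Fin n) := univ.filter (fun x => (α x).isSome)

/-- Value of a literal under a partial assignment. -/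
def plitVal {n : ℕ} (α : PAssign n) (ℓ : Fin n × Bool) : Option Bool :=
  (α ℓ.1).map (fun b => if ℓ.2 then b else !b)

/-- A partial assignment satisfies a 2-clause. -/
def pClauseSat {n : ℕ} (α : PAssign n) (C : Clause n) : Prop :=
  plitVal α C.val.1 = some true ∨ plitVal α C.val.2 = some true

/-- The set of variables of a 2-CNF (a multiset of clauses). -/
def mvars {n : ℕ} (F : Multiset (Clause n)) : Finset (Fin n) := F.toFinset.biUnion vars

/-- `α ∈ sat(H)`: `α` is an assignment to exactly the variables of `H` satisfying `H`. -/
def satAssign {n : ℕ} (H : Multiset (Clause n)) (α : PAssign n) : Prop :=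
  support α = mvars H ∧ ∀ C ∈ H, pClauseSat α C

/-- `F ∧ α` is satisfiable: `α` extends to a total assignment satisfying `F`. -/
def extendable {n : ℕ} (F : Multiset (Clause n)) (α : PAssign n) : Prop :=
  ∃ σ : Fin n → Bool, (∀ x b, α x = some b → σ x = b) ∧ ∀ C ∈ F, clauseSat σ C

/-- `θ(H,F)`: the fraction of `α ∈ sat(H)` such that `F ∧ α` is satisfiable
(`1` if `H` is unsatisfiable). -/
noncomputable def theta {n : ℕ} (H F : Multiset (Clause n)) : ℝ :=
  if Nat.card {α : PAssign n // satAssign H α} = 0 then 1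
  else (Nat.card {α : PAssign n // satAssign H α ∧ extendable F α} : ℝ) /
    (Nat.card {α : PAssign n // satAssign H α} : ℝ)

/-- Partial assignments assigning exactly `k` variables (`𝓕₁(n,k)` sample space). -/
abbrev PAk (n k : ℕ) := {α : PAssign n // (support α).card = k}

/-- The literals over `x_0, …, x_{n-1}`. -/
abbrev Lit (n : ℕ) := Fin n × Bool

/-- The negation of a literal. -/
def negLit {n : ℕ} (a : Lit n) : Lit n := (a.1, !a.2)

@[simp] theorem negLit_negLit {n : ℕ} (a : Lit n) : negLit (negLit a) = a := by
  simp [negLit]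

@[simp] theorem negLit_fst {n : ℕ} (a : Lit n) : (negLit a).1 = a.1 := rfl

theorem negLit_ne {n : ℕ} (a : Lit n) : negLit a ≠ a := by
  intro h
  have := congrArg Prod.snd h
  simp [negLit] at this

theorem eq_or_eq_negLit {n : ℕ} {a b : Lit n} (h : a.1 = b.1) : a = b ∨ a = negLit b := by
  rcases a with ⟨x, s⟩
  rcases b with ⟨y, t⟩
  obtain rfl : x = y := h
  cases s <;> cases t <;> simp [negLit]

/-- A 2-clause as an unordered pair of literals. -/
def clausePair {n : ℕ} (C : Clause n) : Sym2 (Lit n) := s(C.val.1, C.val.2)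

theorem clausePair_injective {n : ℕ} : Function.Injective (clausePair (n := n)) := by
  rintro ⟨⟨a, b⟩, hab⟩ ⟨⟨c, d⟩, hcd⟩ h
  simp only [clausePair, Sym2.eq_iff] at h
  rcases h with ⟨rfl, rfl⟩ | ⟨rfl, rfl⟩
  · rfl
  · exact absurd hab (not_lt.2 hcd.le)

/-- The implication `a → b` given by a clause `¬a ∨ b` of the set `E` of clauses. -/
def Imp {n : ℕ} (E : Set (Sym2 (Lit n))) (a b : Lit n) : Prop := s(negLit a, b) ∈ E

theorem Imp.contrapose {n : ℕ} {E : Set (Sym2 (Lit n))} {a b : Lit n} (h : Imp E a b) :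
    Imp E (negLit b) (negLit a) := by
  simpa [Imp, Sym2.eq_swap] using h

theorem reach_contrapose {n : ℕ} {E : Set (Sym2 (Lit n))} {a b : Lit n}
    (h : Relation.ReflTransGen (Imp E) a b) :
    Relation.ReflTransGen (Imp E) (negLit b) (negLit a) := by
  induction h with
  | refl => exact .refl
  | tail _ hbc ih => exact .head hbc.contrapose ih

/-- A set of literals that can be forced to be true, and from which no contradiction follows,
extends to a complete consistent set closed under implication, unless some literal is
equivalent to its negation. -/
theorem exists_complete_closed {n : ℕ} (E : Set (Sym2 (Lit n))) (S : Set (Lit n))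
    (hS : ∀ a ∈ S, ∀ b ∈ S, ¬ Relation.ReflTransGen (Imp E) a (negLit b))
    (hE : ∀ x, ¬ (Relation.ReflTransGen (Imp E) x (negLit x) ∧
      Relation.ReflTransGen (Imp E) (negLit x) x)) :
    ∃ A : Set (Lit n), S ⊆ A ∧ (∀ a ∈ A, ∀ b, Imp E a b → b ∈ A) ∧
      (∀ a ∈ A, negLit a ∉ A) ∧ ∀ a, a ∈ A ∨ negLit a ∈ A := by
  let P : Set (Lit n) → Prop := fun A =>
    S ⊆ A ∧ (∀ a ∈ A, ∀ b, Relation.ReflTransGen (Imp E) a b → b ∈ A) ∧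
      (∀ a ∈ A, negLit a ∉ A)
  have hP : P {y | ∃ a ∈ S, Relation.ReflTransGen (Imp E) a y} := by
    refine ⟨fun a ha => ⟨a, ha, .refl⟩, ?_, ?_⟩
    · rintro a ⟨c, hc, hca⟩ b hab
      exact ⟨c, hc, hca.trans hab⟩
    · rintro a ⟨c, hc, hca⟩ ⟨d, hd, hda⟩
      have := reach_contrapose hda
      rw [negLit_negLit] at this
      exact hS c hc d hd (hca.trans this)
  obtain ⟨A, -, hA⟩ := (Set.toFinite {A | P A}).exists_le_maximal hP
  obtain ⟨hSA, hcl, hcons⟩ := hA.prop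
  have key : ∀ x, x ∉ A → negLit x ∉ A → Relation.ReflTransGen (Imp E) x (negLit x) := by
    intro x hx hnx
    by_contra hbad
    have hB : P (A ∪ {y | Relation.ReflTransGen (Imp E) x y}) := by
      have aux : ∀ y ∈ A, Relation.ReflTransGen (Imp E) x (negLit y) → False := by
        intro y hy hxy
        have := reach_contrapose hxy
        rw [negLit_negLit] at this
        exact hnx (hcl _ hy _ this)
      refine ⟨hSA.trans Set.subset_union_left, ?_, ?_⟩
      · rintro a (ha | ha) b hab
        · exact Or.inl (hcl a ha b hab)
        · exact Or.inr (Relation.ReflTransGen.trans ha hab)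
      · rintro a (ha | ha) (hb | hb)
        · exact hcons a ha hb
        · exact aux a ha hb
        · exact aux _ hb (by simpa using ha)
        · have := reach_contrapose hb
          rw [negLit_negLit] at this
          exact hbad (Relation.ReflTransGen.trans ha this)
    exact hx (hA.le_of_ge hB Set.subset_union_left (Or.inr .refl))
  refine ⟨A, hSA, fun a ha b hab => hcl a ha b (.single hab), hcons, fun a => ?_⟩
  by_contra! h
  refine hE a ⟨key a h.1 h.2, ?_⟩
  have := key (negLit a) h.2 (by simpa using h.1)
  rwa [negLit_negLit] at this

/-- The literals made true by a partial assignment. -/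
def trueLits {n : ℕ} (α : PAssign n) : Set (Lit n) := {a | α a.1 = some a.2}

theorem negLit_notMem_trueLits {n : ℕ} {α : PAssign n} {a : Lit n} (ha : a ∈ trueLits α) :
    negLit a ∉ trueLits α := by
  intro h
  simp only [trueLits, Set.mem_ofPred_eq, negLit] at ha h
  rw [ha] at h
  simp at h

/-- The satisfiability criterion for 2-CNFs, relative to a partial assignment. -/
theorem reach_of_not_extendable {n : ℕ} (F : Multiset (Clause n)) (α : PAssign n)
    (h : ¬ extendable F α) :
    (∃ a ∈ trueLits α, ∃ b ∈ trueLits α,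
      Relation.ReflTransGen (Imp (clausePair '' {C | C ∈ F})) a (negLit b)) ∨
    ∃ x, Relation.ReflTransGen (Imp (clausePair '' {C | C ∈ F})) x (negLit x) ∧
      Relation.ReflTransGen (Imp (clausePair '' {C | C ∈ F})) (negLit x) x := by
  classical
  by_contra! hcon
  obtain ⟨hS, hE⟩ := hcon
  obtain ⟨A, hSA, hcl, hcons, htot⟩ := exists_complete_closed _ _ hS (fun x hx => hE x hx.1 hx.2)
  refine h ⟨fun x => decide ((x, true) ∈ A), ?_, ?_⟩
  · intro x b hb
    have h1 : (x, b) ∈ A := hSA hb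
    cases b with
    | true => simpa using h1
    | false => simpa [negLit] using hcons _ h1
  · have hval : ∀ a ∈ A, litVal (fun x => decide ((x, true) ∈ A)) a = true := by
      rintro ⟨x, s⟩ ha
      cases s with
      | true => simpa [litVal] using ha
      | false => simpa [litVal, negLit] using hcons _ ha
    intro C hC
    rcases htot C.val.1 with h1 | h1
    · exact Or.inl (hval _ h1)
    · refine Or.inr (hval _ (hcl _ h1 _ ⟨C, hC, ?_⟩))
      simp [clausePair]

/-- The clauses witnessing the successive implications along a list of literals. -/
def pathEdges {n : ℕ} : List (Lit n) → List (Sym2 (Lit n))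
  | [] => []
  | [_] => []
  | a :: b :: l => s(negLit a, b) :: pathEdges (b :: l)

theorem length_pathEdges {n : ℕ} (l : List (Lit n)) : (pathEdges l).length = l.length - 1 := by
  induction l using pathEdges.induct with
  | case1 => rfl
  | case2 => rfl
  | case3 a b l ih => simp [pathEdges, ih]

theorem pathEdges_append_pair {n : ℕ} (l : List (Lit n)) (a b : Lit n) :
    pathEdges (l ++ [a, b]) = pathEdges (l ++ [a]) ++ [s(negLit a, b)] := by
  induction l using pathEdges.induct with
  | case1 => rfl
  | case2 => rfl
  | case3 c d l ih => simpa [pathEdges] using ih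

theorem mem_of_mem_pathEdges {n : ℕ} {l : List (Lit n)} {e : Sym2 (Lit n)} {y : Lit n}
    (he : e ∈ pathEdges l) (hy : y ∈ e) : negLit y ∈ l.dropLast ∨ y ∈ l.tail := by
  induction l using pathEdges.induct with
  | case1 => simp [pathEdges] at he
  | case2 => simp [pathEdges] at he
  | case3 a b l ih =>
    simp only [pathEdges, List.mem_cons] at he
    rcases he with rfl | he
    · rcases Sym2.mem_iff.1 hy with rfl | rfl <;> simp
    · rcases ih he with h | h
      · exact Or.inl (by simpa using Or.inr h)
      · exact Or.inr (List.mem_cons_of_mem _ h)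

theorem mem_pathEdges_of_isChain {n : ℕ} {E : Set (Sym2 (Lit n))} {l : List (Lit n)}
    (h : l.IsChain (Imp E)) : ∀ e ∈ pathEdges l, e ∈ E := by
  induction l using pathEdges.induct with
  | case1 => simp [pathEdges]
  | case2 => simp [pathEdges]
  | case3 a b l ih =>
    rw [List.isChain_cons_cons] at h
    simp only [pathEdges, List.mem_cons]
    rintro e (rfl | he)
    · exact h.1
    · exact ih h.2 e he

/-- The variables of the literals in a list are pairwise distinct. -/
def VarNodup {n : ℕ} (l : List (Lit n)) : Prop := (l.map Prod.fst).Nodup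

theorem VarNodup.eq_of_fst_eq {n : ℕ} {l : List (Lit n)} (h : VarNodup l) {a b : Lit n}
    (ha : a ∈ l) (hb : b ∈ l) (hab : a.1 = b.1) : a = b :=
  List.inj_on_of_nodup_map h ha hb hab

theorem VarNodup.negLit_notMem {n : ℕ} {l : List (Lit n)} (h : VarNodup l) {a : Lit n}
    (ha : a ∈ l) : negLit a ∉ l := fun hb =>
  negLit_ne a (h.eq_of_fst_eq hb ha rfl)

theorem VarNodup.length_le {n : ℕ} {l : List (Lit n)} (h : VarNodup l) : l.length ≤ n := by
  simpa using List.Nodup.length_le_card h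

theorem VarNodup.head_notMem {n : ℕ} {l : List (Lit n)} {a : Lit n} (h : VarNodup (a :: l))
    {e : Sym2 (Lit n)} (he : e ∈ pathEdges (a :: l)) : a ∉ e := by
  intro hae
  rcases mem_of_mem_pathEdges he hae with h1 | h1
  · exact h.negLit_notMem (List.mem_cons_self) (List.dropLast_subset _ h1)
  · have : (a :: l).Nodup := List.Nodup.of_map _ h
    exact (List.nodup_cons.1 this).1 h1

theorem VarNodup.last_notMem {n : ℕ} {l : List (Lit n)} {a : Lit n} (h : VarNodup (l ++ [a]))
    {e : Sym2 (Lit n)} (he : e ∈ pathEdges (l ++ [a])) : negLit a ∉ e := by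
  intro hae
  rcases mem_of_mem_pathEdges he hae with h1 | h1
  · have : (l ++ [a]).Nodup := List.Nodup.of_map _ h
    rw [List.nodup_append] at this
    simp only [negLit_negLit, List.dropLast_concat] at h1
    exact this.2.2 a h1 a (by simp) rfl
  · exact h.negLit_notMem (a := a) (by simp) (List.tail_subset _ h1)

theorem VarNodup.pathEdges_nodup {n : ℕ} {l : List (Lit n)} (h : VarNodup l) :
    (pathEdges l).Nodup := by
  induction l using pathEdges.induct with
  | case1 => simp [pathEdges]
  | case2 => simp [pathEdges]
  | case3 a b l ih =>
    have h' : VarNodup (b :: l) := by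
      simp only [VarNodup, List.map_cons, List.nodup_cons] at h ⊢
      exact h.2
    refine List.nodup_cons.2 ⟨fun hmem => ?_, ih h'⟩
    exact h'.head_notMem hmem (by simp)

theorem VarNodup.pathEdges_concat_nodup {n : ℕ} {l : List (Lit n)} (h : VarNodup l) (v : Lit n) :
    (pathEdges (l ++ [v])).Nodup := by
  rcases List.eq_nil_or_concat l with rfl | ⟨l, a, rfl⟩
  · simp [pathEdges]
  · rw [List.concat_eq_append] at h ⊢
    rw [List.append_assoc, List.singleton_append, pathEdges_append_pair, List.nodup_append]
    refine ⟨h.pathEdges_nodup, by simp, ?_⟩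
    rintro e he f hf rfl
    rw [List.mem_singleton] at hf
    subst hf
    exact h.last_notMem he (by simp)

theorem VarNodup.pathEdges_bicycle_nodup {n : ℕ} {l : List (Lit n)} (h : VarNodup l)
    (u v : Lit n) (hv : negLit v ∈ l) : (pathEdges (u :: (l ++ [v]))).Nodup := by
  rcases l with _ | ⟨b, l⟩
  · simp at hv
  refine List.nodup_cons.2 ⟨fun hmem => ?_, h.pathEdges_concat_nodup v⟩
  obtain ⟨l', a, hl⟩ := (List.eq_nil_or_concat (b :: l)).resolve_left (by simp)
  rw [List.concat_eq_append] at hl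
  change s(negLit u, b) ∈ pathEdges (b :: l ++ [v]) at hmem
  rw [hl, List.append_assoc, List.singleton_append, pathEdges_append_pair, ← hl,
    List.mem_append, List.mem_singleton] at hmem
  have hb : b ∈ b :: l := List.mem_cons_self
  have ha : a ∈ b :: l := by simp [hl]
  rcases hmem with hmem | hmem
  · exact h.head_notMem hmem (by simp)
  · have : b ∈ s(negLit a, v) := by rw [← hmem]; simp
    rcases Sym2.mem_iff.1 this with h1 | h1
    · exact h.negLit_notMem ha (h1 ▸ hb)
    · exact h.negLit_notMem hb (h1 ▸ hv)

/-- A literal reachable from `a` is the end of a path on distinct variables, or such a path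
from `a` continues to the negation of one of its literals. -/
theorem exists_path_or_lollipop {n : ℕ} {E : Set (Sym2 (Lit n))} {a b : Lit n}
    (h : Relation.ReflTransGen (Imp E) a b) :
    (∃ l : List (Lit n), VarNodup (a :: l) ∧ (a :: l).IsChain (Imp E) ∧
      (a :: l).getLast (by simp) = b) ∨
    ∃ (l : List (Lit n)) (v : Lit n), VarNodup (a :: l) ∧
      (a :: l ++ [v]).IsChain (Imp E) ∧ negLit v ∈ a :: l := by
  induction h with
  | refl => exact Or.inl ⟨[], by simp [VarNodup], by simp, rfl⟩
  | @tail b c _ hbc ih =>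
    rcases ih with ⟨l, hl, hch, hlast⟩ | h
    · have hch' : (a :: l ++ [c]).IsChain (Imp E) := by
        rw [List.isChain_append]
        refine ⟨hch, by simp, ?_⟩
        intro x hx y hy
        rw [List.getLast?_eq_some_getLast (by simp), hlast] at hx
        simp at hx hy
        subst hx hy
        exact hbc
      by_cases hc : c ∈ a :: l
      · left
        obtain ⟨p, q, hpq⟩ := List.append_of_mem hc
        rcases p with _ | ⟨d, p⟩
        · simp only [List.nil_append, List.cons.injEq] at hpq
          exact ⟨[], by simp [VarNodup], by simp, by simp [hpq.1]⟩
        · simp only [List.cons_append, List.cons.injEq] at hpq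
          obtain ⟨rfl, rfl⟩ := hpq
          refine ⟨p ++ [c], ?_, ?_, by simp⟩
          · refine List.Nodup.sublist (List.Sublist.map _ ?_) hl
            simp
          · refine hch.prefix ⟨q, by simp⟩
      · by_cases hc' : negLit c ∈ a :: l
        · exact Or.inr ⟨l, c, hl, hch', hc'⟩
        · refine Or.inl ⟨l ++ [c], ?_, hch', by simp⟩
          have : ((a :: l ++ [c]).map Prod.fst).Nodup := by
            rw [List.map_append, List.nodup_append]
            refine ⟨hl, by simp, ?_⟩
            intro x hx y hy hxy
            simp only [List.map_cons, List.map_nil, List.mem_singleton] at hy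
            obtain ⟨d, hd, rfl⟩ := List.mem_map.1 hx
            rcases eq_or_eq_negLit (hxy.trans hy) with rfl | rfl
            · exact hc hd
            · exact hc' hd
          exact this
    · exact Or.inr h

/-- A path on distinct variables starting at a literal `x` that is implied by its negation
extends to the left to a path whose first literal is implied by one of its own literals,
up to sign. -/
theorem exists_left_extension {n : ℕ} {E : Set (Sym2 (Lit n))} {x : Lit n} {l : List (Lit n)}
    (hl : VarNodup (x :: l)) (h : Relation.ReflTransGen (Imp E) (negLit x) x) :
    ∃ (p : List (Lit n)) (u : Lit n), VarNodup (p ++ x :: l) ∧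
      (∀ t, (x :: l ++ t).IsChain (Imp E) → (u :: (p ++ x :: l ++ t)).IsChain (Imp E)) ∧
      ∃ b ∈ p ++ x :: l, b.1 = u.1 := by
  have key : ∀ c, Relation.ReflTransGen (Imp E) c x →
      (∃ (p : List (Lit n)) (u : Lit n), VarNodup (p ++ x :: l) ∧
      (∀ t, (x :: l ++ t).IsChain (Imp E) → (u :: (p ++ x :: l ++ t)).IsChain (Imp E)) ∧
      ∃ b ∈ p ++ x :: l, b.1 = u.1) ∨
      ∃ p : List (Lit n), VarNodup (p ++ x :: l) ∧
      (∀ t, (x :: l ++ t).IsChain (Imp E) → (p ++ x :: l ++ t).IsChain (Imp E)) ∧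
      (p ++ x :: l).head? = some c := by
    intro c hc
    induction hc using Relation.ReflTransGen.head_induction_on with
    | refl => exact Or.inr ⟨[], hl, fun t ht => ht, rfl⟩
    | @head d c hdc _ ih =>
      rcases ih with h | ⟨p, hp, hch, hhead⟩
      · exact Or.inl h
      · have hch' : ∀ t, (x :: l ++ t).IsChain (Imp E) →
            (d :: (p ++ x :: l ++ t)).IsChain (Imp E) := by
          intro t ht
          rw [List.isChain_cons]
          refine ⟨?_, hch t ht⟩
          intro y hy
          rw [List.head?_append, hhead] at hy
          simp at hy
          exact hy ▸ hdc
        by_cases hd : ∃ b ∈ p ++ x :: l, b.1 = d.1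
        · exact Or.inl ⟨p, d, hp, hch', hd⟩
        · refine Or.inr ⟨d :: p, ?_, hch', rfl⟩
          refine List.nodup_cons.2 ⟨fun hmem => hd ?_, hp⟩
          exact List.mem_map.1 hmem
  rcases key _ h with h | ⟨p, hp, -, hhead⟩
  · exact h
  · exact absurd (List.mem_of_head? hhead) (hp.negLit_notMem (by simp))

/-- The obstructions to extending a partial assignment to a satisfying assignment. -/
theorem exists_obstruction {n : ℕ} (F : Multiset (Clause n)) (α : PAssign n)
    (h : ¬ extendable F α) :
    (∃ a ∈ trueLits α, ∃ b ∈ trueLits α, ∃ l : List (Lit n),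
      VarNodup (a :: l ++ [negLit b]) ∧
      ∀ e ∈ pathEdges (a :: l ++ [negLit b]), e ∈ clausePair '' {C | C ∈ F}) ∨
    (∃ a ∈ trueLits α, ∃ (l : List (Lit n)) (v : Lit n), VarNodup (a :: l) ∧
      negLit v ∈ a :: l ∧
      ∀ e ∈ pathEdges (a :: l ++ [v]), e ∈ clausePair '' {C | C ∈ F}) ∨
    ∃ (l : List (Lit n)) (u v : Lit n), VarNodup l ∧ negLit v ∈ l ∧ (∃ b ∈ l, b.1 = u.1) ∧
      ∀ e ∈ pathEdges (u :: (l ++ [v])), e ∈ clausePair '' {C | C ∈ F} := by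
  rcases reach_of_not_extendable F α h with ⟨a, ha, b, hb, hab⟩ | ⟨x, hx, hx'⟩
  · rcases exists_path_or_lollipop hab with ⟨l, hl, hch, hlast⟩ | ⟨l, v, hl, hch, hv⟩
    · left
      refine ⟨a, ha, b, hb, ?_⟩
      rcases List.eq_nil_or_concat l with rfl | ⟨l, c, rfl⟩
      · simp only [List.getLast_singleton] at hlast
        exact absurd (hlast ▸ ha) (negLit_notMem_trueLits hb)
      · simp only [List.concat_eq_append] at hl hch hlast
        rw [List.getLast_cons (by simp), List.getLast_append_singleton] at hlast
        subst hlast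
        exact ⟨l, hl, mem_pathEdges_of_isChain hch⟩
    · exact Or.inr (Or.inl ⟨a, ha, l, v, hl, hv, mem_pathEdges_of_isChain hch⟩)
  · right; right
    rcases exists_path_or_lollipop hx with ⟨l, hl, hch, hlast⟩ | ⟨l, v, hl, hch, hv⟩
    · exact absurd (hlast ▸ List.getLast_mem _) (hl.negLit_notMem (a := x) (by simp))
    · obtain ⟨p, u, hp, hch', hu⟩ := exists_left_extension hl hx'
      exact ⟨p ++ x :: l, u, v, hp, List.mem_append_right _ hv, hu,
        mem_pathEdges_of_isChain (hch' [v] hch)⟩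

open Classical in
theorem pr_eq_card_filter {Ω : Type*} [Fintype Ω] (P : Ω → Prop) :
    pr Ω P = ((univ.filter P).card : ℝ) / (Fintype.card Ω : ℝ) := by
  rw [pr, Nat.card_eq_fintype_card, Fintype.card_subtype]

theorem pr_nonneg {Ω : Type*} [Fintype Ω] (P : Ω → Prop) : 0 ≤ pr Ω P := by
  unfold pr
  positivity

/-- The union bound. -/
theorem pr_le_sum {Ω ι : Type*} [Fintype Ω] (s : Finset ι) (P : Ω → Prop) (Q : ι → Ω → Prop)
    (h : ∀ ω, P ω → ∃ i ∈ s, Q i ω) : pr Ω P ≤ ∑ i ∈ s, pr Ω (Q i) := by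
  classical
  simp only [pr_eq_card_filter]
  rw [← Finset.sum_div]
  gcongr
  have : univ.filter P ⊆ s.biUnion (fun i => univ.filter (Q i)) := by
    intro ω hω
    simp only [mem_filter, mem_univ, true_and, mem_biUnion] at hω ⊢
    exact h ω hω
  exact_mod_cast (Finset.card_le_card this).trans Finset.card_biUnion_le

theorem card_comp_eq_mul_le {Ω κ ι : Type*} [Fintype Ω] [Fintype κ] [Fintype ι] {f : κ → ι}
    (hf : Function.Injective f) (g : κ → Ω) :
    Nat.card {C : ι → Ω // C ∘ f = g} * Nat.card (κ → Ω) ≤ Nat.card (ι → Ω) := by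
  rw [← Nat.card_prod]
  refine Nat.card_le_card_of_injective
    (fun x : {C : ι → Ω // C ∘ f = g} × (κ → Ω) => Function.extend f x.2 x.1.1) ?_
  rintro ⟨⟨C, hC⟩, h⟩ ⟨⟨C', hC'⟩, h'⟩ heq
  simp only at heq
  have hh : h = h' := by
    funext j
    have := congrFun heq (f j)
    rwa [hf.extend_apply, hf.extend_apply] at this
  have hCC : C = C' := by
    funext i
    by_cases hi : ∃ j, f j = i
    · obtain ⟨j, rfl⟩ := hi
      exact congrFun (hC.trans hC'.symm) j
    · have := congrFun heq i
      rwa [Function.extend_apply' _ _ _ hi, Function.extend_apply' _ _ _ hi] at this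
  subst hh hCC
  rfl

/-- The probability that `t` given distinct values all occur among `m` independent uniform
samples. -/
theorem pr_forall_exists_eq_le {Ω : Type*} [Fintype Ω] [Nonempty Ω] (m t : ℕ) (g : Fin t → Ω)
    (hg : Function.Injective g) :
    pr (Fin m → Ω) (fun C => ∀ j, ∃ i, C i = g j) ≤ ((m : ℝ) / Fintype.card Ω) ^ t := by
  classical
  have hN : (0 : ℝ) < Fintype.card Ω := by exact_mod_cast Fintype.card_pos
  have hle : ∀ f : Fin t → Fin m,
      pr (Fin m → Ω) (fun C => C ∘ f = g) ≤ ((Fintype.card Ω : ℝ) ^ t)⁻¹ := by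
    intro f
    by_cases hf : Function.Injective f
    · have := card_comp_eq_mul_le hf g
      rw [pr, inv_eq_one_div, div_le_div_iff₀ (by simp only [Fintype.card_fun]; positivity)
        (by positivity), one_mul]
      simp only [Nat.card_eq_fintype_card, Fintype.card_fun, Fintype.card_fin] at this ⊢
      exact_mod_cast this
    · have : IsEmpty {C : Fin m → Ω // C ∘ f = g} :=
        ⟨fun C => hf (Function.Injective.of_comp (f := C.1) (by rw [C.2]; exact hg))⟩
      rw [pr, Nat.card_of_isEmpty]
      simp
  calc pr (Fin m → Ω) (fun C => ∀ j, ∃ i, C i = g j)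
      ≤ ∑ f : Fin t → Fin m, pr (Fin m → Ω) (fun C => C ∘ f = g) := by
        refine pr_le_sum _ _ _ fun C hC => ?_
        choose f hf using hC
        exact ⟨f, mem_univ _, funext hf⟩
    _ ≤ ∑ _f : Fin t → Fin m, ((Fintype.card Ω : ℝ) ^ t)⁻¹ := sum_le_sum fun f _ => hle f
    _ = ((m : ℝ) / Fintype.card Ω) ^ t := by
        simp [mul_pow, div_eq_mul_inv]

/-- The set of clauses of a sequence of clauses, as unordered pairs. -/
def pairSet {n m : ℕ} (C : Fin m → Clause n) : Set (Sym2 (Lit n)) :=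
  clausePair '' {c | c ∈ ((List.ofFn C : List (Clause n)) : Multiset (Clause n))}

theorem pr_forall_mem_pairSet_le {n m : ℕ} [Nonempty (Clause n)] (L : List (Sym2 (Lit n)))
    (hL : L.Nodup) :
    pr (Fin m → Clause n) (fun C => ∀ e ∈ L, e ∈ pairSet C) ≤
      ((m : ℝ) / Fintype.card (Clause n)) ^ L.length := by
  by_cases hc : ∀ j : Fin L.length, ∃ c : Clause n, clausePair c = L.get j
  · choose g hg using hc
    have hinj : Function.Injective g := fun i j hij =>
      (List.nodup_iff_injective_get.1 hL) (by rw [← hg, ← hg, hij])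
    refine le_trans ?_ (pr_forall_exists_eq_le m L.length g hinj)
    refine (pr_le_sum {()} _ (fun _ C => ∀ j, ∃ i, C i = g j) fun C hC => ?_).trans (by simp)
    refine ⟨(), by simp, fun j => ?_⟩
    obtain ⟨c, hcm, hce⟩ := hC _ (L.get_mem j)
    rw [← hg j] at hce
    have := clausePair_injective hce
    subst this
    simpa using hcm
  · push Not at hc
    obtain ⟨j, hj⟩ := hc
    have : IsEmpty {C : Fin m → Clause n // ∀ e ∈ L, e ∈ pairSet C} := by
      refine ⟨fun C => ?_⟩
      obtain ⟨c, -, hce⟩ := C.2 _ (L.get_mem j)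
      exact hj c hce
    rw [pr, Nat.card_of_isEmpty]
    simp only [Nat.cast_zero, zero_div]
    positivity

theorem pr_exists_path_le {n m t : ℕ} [Nonempty (Clause n)] {ι : Type*} [Fintype ι]
    (L : ι → List (Lit n)) (hL : ∀ i, (L i).length = t + 1) :
    pr (Fin m → Clause n)
      (fun C => ∃ i, (pathEdges (L i)).Nodup ∧ ∀ e ∈ pathEdges (L i), e ∈ pairSet C) ≤
      Fintype.card ι * ((m : ℝ) / Fintype.card (Clause n)) ^ t := by
  calc _ ≤ ∑ i : ι, pr (Fin m → Clause n)
        (fun C => (pathEdges (L i)).Nodup ∧ ∀ e ∈ pathEdges (L i), e ∈ pairSet C) :=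
        pr_le_sum _ _ _ fun C ⟨i, hi⟩ => ⟨i, mem_univ _, hi⟩
    _ ≤ ∑ _i : ι, ((m : ℝ) / Fintype.card (Clause n)) ^ t := by
        refine sum_le_sum fun i _ => ?_
        by_cases h : (pathEdges (L i)).Nodup
        · have := pr_forall_mem_pairSet_le (m := m) _ h
          rw [length_pathEdges, hL, Nat.add_sub_cancel] at this
          simpa [h] using this
        · simp only [h, false_and]
          rw [pr, Nat.card_of_isEmpty]
          simp only [Nat.cast_zero, zero_div]
          positivity
    _ = _ := by simp

theorem card_trueLits_le {n : ℕ} (α : PAssign n) :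
    Nat.card (trueLits α) ≤ (support α).card := by
  rw [← Nat.card_eq_finsetCard]
  refine Nat.card_le_card_of_injective
    (fun a : trueLits α => (⟨a.1.1, by
      have h : α a.1.1 = some a.1.2 := a.2
      simp [support, h]⟩ : support α)) ?_
  rintro ⟨⟨x, s⟩, ha⟩ ⟨⟨y, t⟩, hb⟩ hab
  obtain rfl : x = y := congrArg Subtype.val hab
  have ha : α x = some s := ha
  have hb : α x = some t := hb
  obtain rfl : s = t := Option.some.inj (ha.symm.trans hb)
  rfl

theorem card_clause (n : ℕ) : Fintype.card (Clause n) = 2 * n * (n - 1) := by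
  have h : Fintype.card (Clause n) = 4 * Fintype.card {p : Fin n × Fin n // p.1 < p.2} := by
    have e : Clause n ≃ (Bool × Bool) × {p : Fin n × Fin n // p.1 < p.2} :=
      { toFun := fun C => ((C.1.1.2, C.1.2.2), ⟨(C.1.1.1, C.1.2.1), C.2⟩)
        invFun := fun x => ⟨((x.2.1.1, x.1.1), (x.2.1.2, x.1.2)), x.2.2⟩
        left_inv := fun _ => rfl
        right_inv := fun _ => rfl }
    rw [Fintype.card_congr e]
    simp
  have h2 : Fintype.card {p : Fin n × Fin n // p.1 < p.2} = ∑ i : Fin n, (n - 1 - (i : ℕ)) := by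
    rw [Fintype.card_congr (Equiv.subtypeProdEquivSigmaSubtype (fun a b : Fin n => a < b)),
      Fintype.card_sigma]
    refine sum_congr rfl fun i _ => ?_
    rw [Fintype.card_subtype, Finset.filter_lt_eq_Ioi, Fin.card_Ioi]
  rw [h, h2, Fin.sum_univ_eq_sum_range (fun i => n - 1 - i) n, Finset.sum_range_reflect (fun i => i)]
  have := Finset.sum_range_id_mul_two n
  rw [mul_assoc, ← this]
  ring

theorem card_vector_lit (n r : ℕ) : Fintype.card (List.Vector (Lit n) r) = (2 * n) ^ r := by
  rw [card_vector, Fintype.card_prod, Fintype.card_fin, Fintype.card_bool, mul_comm]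

/-- The first moment bound for paths joining two assigned literals. -/
theorem pr_path_le {n m : ℕ} [Nonempty (Clause n)] (α : PAssign n) (r : ℕ) :
    pr (Fin m → Clause n) (fun C => ∃ a ∈ trueLits α, ∃ b ∈ trueLits α, ∃ l : List (Lit n),
      l.length = r ∧ VarNodup (a :: l ++ [negLit b]) ∧
      ∀ e ∈ pathEdges (a :: l ++ [negLit b]), e ∈ pairSet C) ≤
    ((Nat.card (trueLits α) * Nat.card (trueLits α) * (2 * n) ^ r : ℕ) : ℝ) *
      ((m : ℝ) / Fintype.card (Clause n)) ^ (r + 1) := by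
  classical
  have := pr_exists_path_le (m := m) (t := r + 1)
    (ι := trueLits α × trueLits α × List.Vector (Lit n) r)
    (fun i => i.1.1 :: i.2.2.1 ++ [negLit i.2.1.1]) (fun i => by simp [i.2.2.2])
  rw [Fintype.card_prod, Fintype.card_prod, card_vector_lit, ← Nat.card_eq_fintype_card,
    ← mul_assoc] at this
  refine le_trans ?_ this
  refine (pr_le_sum {()} _ (fun _ => _) fun C hC => ⟨(), by simp, ?_⟩).trans
    (Finset.sum_singleton _ _).le
  obtain ⟨a, ha, b, hb, l, hr, hl, he⟩ := hC
  exact ⟨⟨⟨a, ha⟩, ⟨b, hb⟩, ⟨l, hr⟩⟩, hl.pathEdges_nodup, he⟩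

/-- The first moment bound for paths from an assigned literal to the negation of one of their
literals. -/
theorem pr_lollipop_le {n m : ℕ} [Nonempty (Clause n)] (α : PAssign n) (r : ℕ) :
    pr (Fin m → Clause n) (fun C => ∃ a ∈ trueLits α, ∃ (l : List (Lit n)) (v : Lit n),
      l.length = r ∧ VarNodup (a :: l) ∧ negLit v ∈ a :: l ∧
      ∀ e ∈ pathEdges (a :: l ++ [v]), e ∈ pairSet C) ≤
    ((Nat.card (trueLits α) * (2 * n) ^ r * (r + 1) : ℕ) : ℝ) *
      ((m : ℝ) / Fintype.card (Clause n)) ^ (r + 1) := by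
  classical
  have := pr_exists_path_le (m := m) (t := r + 1)
    (ι := trueLits α × List.Vector (Lit n) r × Fin (r + 1))
    (fun i => i.1.1 :: i.2.1.1 ++ [negLit ((i.1.1 :: i.2.1.1).getD i.2.2 i.1.1)])
    (fun i => by simp [i.2.1.2])
  rw [Fintype.card_prod, Fintype.card_prod, card_vector_lit, ← Nat.card_eq_fintype_card,
    ← mul_assoc, Fintype.card_fin] at this
  refine le_trans ?_ this
  refine (pr_le_sum {()} _ (fun _ => _) fun C hC => ⟨(), by simp, ?_⟩).trans
    (Finset.sum_singleton _ _).le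
  obtain ⟨a, ha, l, v, hr, hl, hv, he⟩ := hC
  obtain ⟨j, hj, hjv⟩ := List.mem_iff_getElem.1 hv
  have hv' : negLit ((a :: l).getD j a) = v := by
    rw [List.getD_eq_getElem _ _ hj, hjv, negLit_negLit]
  refine ⟨⟨⟨a, ha⟩, ⟨l, hr⟩, ⟨j, by simpa [hr] using hj⟩⟩, ?_⟩
  simp only [hv']
  exact ⟨hl.pathEdges_concat_nodup v, he⟩

/-- The first moment bound for bicycles. -/
theorem pr_bicycle_le {n m : ℕ} [Nonempty (Clause n)] (r : ℕ) :
    pr (Fin m → Clause n) (fun C => ∃ (l : List (Lit n)) (u v : Lit n),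
      l.length = r + 1 ∧ VarNodup l ∧ negLit v ∈ l ∧ (∃ b ∈ l, b.1 = u.1) ∧
      ∀ e ∈ pathEdges (u :: (l ++ [v])), e ∈ pairSet C) ≤
    (((2 * n) ^ (r + 1) * ((r + 1) * 2 * (r + 1)) : ℕ) : ℝ) *
      ((m : ℝ) / Fintype.card (Clause n)) ^ (r + 2) := by
  classical
  have hpos : ∀ l : List.Vector (Lit n) (r + 1), ∀ j : Fin (r + 1), (j : ℕ) < l.1.length :=
    fun l j => by rw [l.2]; exact j.2
  have := pr_exists_path_le (m := m) (t := r + 2)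
    (ι := List.Vector (Lit n) (r + 1) × (Fin (r + 1) × Bool) × Fin (r + 1))
    (fun i => ((i.1.1[i.2.1.1]'(hpos _ _)).1, i.2.1.2) ::
      (i.1.1 ++ [negLit (i.1.1[i.2.2]'(hpos _ _))]))
    (fun i => by simp [i.1.2])
  rw [Fintype.card_prod, Fintype.card_prod, card_vector_lit, Fintype.card_prod,
    Fintype.card_fin, Fintype.card_bool] at this
  refine le_trans ?_ this
  refine (pr_le_sum {()} _ (fun _ => _) fun C hC => ⟨(), by simp, ?_⟩).trans
    (Finset.sum_singleton _ _).le
  obtain ⟨l, u, v, hr, hl, hv, ⟨b, hb, hbu⟩, he⟩ := hC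
  obtain ⟨j, hj, hjv⟩ := List.mem_iff_getElem.1 hv
  obtain ⟨i, hi, hib⟩ := List.mem_iff_getElem.1 hb
  have hv' : negLit l[j] = v := by rw [hjv, negLit_negLit]
  have hu' : (l[i].1, u.2) = u := by rw [hib, hbu]
  refine ⟨⟨⟨l, hr⟩, (⟨i, hr ▸ hi⟩, u.2), ⟨j, hr ▸ hj⟩⟩, ?_⟩
  simp only [Fin.getElem_fin, hv', hu']
  exact ⟨hl.pathEdges_bicycle_nodup u v hv, he⟩

/-- Below density `1`, a partial assignment to `s` variables fails to extend to a satisfying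
assignment with probability `O((s + 1)² / n)`. -/
theorem pr_not_extendable_le {Q K : ℝ} (hQ0 : 0 ≤ Q) (hQ1 : Q ≤ 1)
    (hK : ∀ N : ℕ, ∑ r ∈ range N, ((r : ℝ) + 1) ^ 2 * Q ^ (r + 1) ≤ K)
    {n m : ℕ} (hn : 2 ≤ n) (hm : (m : ℝ) ≤ Q * (n - 1)) (α : PAssign n) :
    pr (Fin m → Clause n) (fun C => ¬ extendable (↑(List.ofFn C) : Multiset (Clause n)) α) ≤
      4 * (((support α).card : ℝ) + 1) ^ 2 / n * K := by
  have hN := card_clause n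
  have hn' : (2 : ℝ) ≤ n := by exact_mod_cast hn
  have hNr : (Fintype.card (Clause n) : ℝ) = 2 * n * (n - 1) := by
    rw [hN]
    push_cast [Nat.cast_sub (show 1 ≤ n by omega)]
    ring
  have hNpos : (0 : ℝ) < 2 * n * (n - 1) := by
    have : (0 : ℝ) < n - 1 := by linarith
    positivity
  have : Nonempty (Clause n) := by
    rw [← Fintype.card_pos_iff]
    exact_mod_cast hNr ▸ hNpos
  set p : ℝ := (m : ℝ) / Fintype.card (Clause n) with hp
  have hp0 : 0 ≤ p := by positivity
  have hpQ : 2 * n * p ≤ Q := by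
    rw [hp, hNr, mul_div_assoc', div_le_iff₀ hNpos]
    nlinarith
  have hpow : ∀ r : ℕ, (2 * (n : ℝ)) ^ r * p ^ (r + 1) ≤ Q ^ (r + 1) / n := by
    intro r
    rw [le_div_iff₀ (by linarith)]
    calc (2 * (n : ℝ)) ^ r * p ^ (r + 1) * n ≤ (2 * (n : ℝ)) ^ r * p ^ (r + 1) * (2 * n) := by
          gcongr
          linarith
      _ = (2 * n * p) ^ (r + 1) := by ring
      _ ≤ Q ^ (r + 1) := by gcongr
  set t : ℝ := (Nat.card (trueLits α) : ℝ) with ht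
  set s : ℝ := ((support α).card : ℝ) with hs
  have hts : t ≤ s := by
    rw [ht, hs]
    exact_mod_cast card_trueLits_le α
  have ht0 : 0 ≤ t := by positivity
  have hpow' : ∀ r : ℕ, (2 * (n : ℝ)) ^ (r + 1) * p ^ (r + 2) ≤ Q ^ (r + 1) / n := by
    intro r
    refine (hpow (r + 1)).trans ?_
    have : Q ^ (r + 1 + 1) ≤ Q ^ (r + 1) := pow_le_pow_of_le_one hQ0 hQ1 (by omega)
    gcongr
  let P₁ : ℕ → (Fin m → Clause n) → Prop := fun r C =>
    ∃ a ∈ trueLits α, ∃ b ∈ trueLits α, ∃ l : List (Lit n),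
      l.length = r ∧ VarNodup (a :: l ++ [negLit b]) ∧
      ∀ e ∈ pathEdges (a :: l ++ [negLit b]), e ∈ pairSet C
  let P₂ : ℕ → (Fin m → Clause n) → Prop := fun r C =>
    ∃ a ∈ trueLits α, ∃ (l : List (Lit n)) (v : Lit n),
      l.length = r ∧ VarNodup (a :: l) ∧ negLit v ∈ a :: l ∧
      ∀ e ∈ pathEdges (a :: l ++ [v]), e ∈ pairSet C
  let P₃ : ℕ → (Fin m → Clause n) → Prop := fun r C =>
    ∃ (l : List (Lit n)) (u v : Lit n),
      l.length = r + 1 ∧ VarNodup l ∧ negLit v ∈ l ∧ (∃ b ∈ l, b.1 = u.1) ∧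
      ∀ e ∈ pathEdges (u :: (l ++ [v])), e ∈ pairSet C
  have h₁ : ∀ r, pr _ (P₁ r) ≤ (s + 1) ^ 2 / n * (((r : ℝ) + 1) ^ 2 * Q ^ (r + 1)) := by
    intro r
    refine (pr_path_le α r).trans ?_
    push_cast
    calc t * t * (2 * (n : ℝ)) ^ r * p ^ (r + 1)
        = t ^ 2 * 1 * ((2 * (n : ℝ)) ^ r * p ^ (r + 1)) := by ring
      _ ≤ (s + 1) ^ 2 * ((r : ℝ) + 1) ^ 2 * (Q ^ (r + 1) / n) := by
          gcongr
          · linarith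
          · exact one_le_pow₀ (by linarith [Nat.cast_nonneg (α := ℝ) r])
          · exact hpow r
      _ = _ := by ring
  have h₂ : ∀ r, pr _ (P₂ r) ≤ (s + 1) ^ 2 / n * (((r : ℝ) + 1) ^ 2 * Q ^ (r + 1)) := by
    intro r
    refine (pr_lollipop_le α r).trans ?_
    push_cast
    calc t * (2 * (n : ℝ)) ^ r * (r + 1) * p ^ (r + 1)
        = t * ((r : ℝ) + 1) * ((2 * (n : ℝ)) ^ r * p ^ (r + 1)) := by ring
      _ ≤ (s + 1) ^ 2 * ((r : ℝ) + 1) ^ 2 * (Q ^ (r + 1) / n) := by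
          gcongr
          · nlinarith
          · exact le_self_pow₀ (by linarith [Nat.cast_nonneg (α := ℝ) r]) (by norm_num)
          · exact hpow r
      _ = _ := by ring
  have h₃ : ∀ r, pr _ (P₃ r) ≤ 2 * ((s + 1) ^ 2 / n * (((r : ℝ) + 1) ^ 2 * Q ^ (r + 1))) := by
    intro r
    refine (pr_bicycle_le r).trans ?_
    push_cast
    calc (2 * (n : ℝ)) ^ (r + 1) * (((r : ℝ) + 1) * 2 * (r + 1)) * p ^ (r + 2)
        = 2 * (1 * ((r : ℝ) + 1) ^ 2 * ((2 * (n : ℝ)) ^ (r + 1) * p ^ (r + 2))) := by ring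
      _ ≤ 2 * ((s + 1) ^ 2 * ((r : ℝ) + 1) ^ 2 * (Q ^ (r + 1) / n)) := by
          gcongr
          · exact one_le_pow₀ (by linarith)
          · exact hpow' r
      _ = _ := by ring
  have hunion : ∀ C : Fin m → Clause n,
      ¬ extendable (↑(List.ofFn C) : Multiset (Clause n)) α →
      ∃ x ∈ range (n + 1) ×ˢ (univ : Finset (Fin 3)), (![P₁, P₂, P₃] x.2 x.1) C := by
    intro C hC
    rcases exists_obstruction _ α hC with ⟨a, ha, b, hb, l, hl, he⟩ | ⟨a, ha, l, v, hl, hv, he⟩ |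
      ⟨l, u, v, hl, hv, hu, he⟩
    · have := hl.length_le
      simp only [List.length_append, List.length_cons] at this
      exact ⟨(l.length, 0), by simp; omega, a, ha, b, hb, l, rfl, hl, he⟩
    · have := hl.length_le
      simp only [List.length_cons] at this
      exact ⟨(l.length, 1), by simp; omega, a, ha, l, v, rfl, hl, hv, he⟩
    · have := hl.length_le
      have := List.length_pos_of_mem hv
      exact ⟨(l.length - 1, 2), by simp; omega, l, u, v, by simp; omega, hl, hv, hu, he⟩
  calc _ ≤ _ := pr_le_sum _ _ _ hunion
    _ = ∑ r ∈ range (n + 1), (pr _ (P₁ r) + pr _ (P₂ r) + pr _ (P₃ r)) := by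
        rw [sum_product]
        simp [Fin.sum_univ_three]
    _ ≤ ∑ r ∈ range (n + 1), 4 * (s + 1) ^ 2 / n * (((r : ℝ) + 1) ^ 2 * Q ^ (r + 1)) := by
        refine sum_le_sum fun r _ => (add_le_add (add_le_add (h₁ r) (h₂ r)) (h₃ r)).trans_eq ?_
        ring
    _ ≤ 4 * (s + 1) ^ 2 / n * K := by
        rw [← mul_sum]
        gcongr
        exact hK _

theorem card_mvars_ofFn_le {n k : ℕ} (A : Fin k → Clause n) :
    (mvars (↑(List.ofFn A) : Multiset (Clause n))).card ≤ 2 * k := by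
  calc _ ≤ ∑ _C ∈ (↑(List.ofFn A) : Multiset (Clause n)).toFinset, 2 :=
        card_biUnion_le.trans (sum_le_sum fun C _ => card_le_two)
    _ ≤ _ := by
        rw [sum_const, smul_eq_mul, mul_comm]
        gcongr
        exact (Multiset.toFinset_card_le _).trans (by simp)

/-- Markov's inequality for the fraction of non-extendable satisfying assignments. -/
theorem pr_theta_lt_le {n k l : ℕ} {ε : ℝ} (A : Fin k → Clause n)
    (hε : ∀ α : PAssign n, (support α).card ≤ 2 * k →
      pr (Fin l → Clause n) (fun B => ¬ extendable (↑(List.ofFn B) : Multiset (Clause n)) α) ≤ ε) :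
    pr (Fin l → Clause n) (fun B => theta (↑(List.ofFn A) : Multiset (Clause n))
      (↑(List.ofFn B) : Multiset (Clause n)) < 2 / 3) ≤ 3 * ε := by
  classical
  have hε0 : 0 ≤ ε := by
    refine (pr_nonneg _).trans (hε (fun _ => none) ?_)
    simp [support]
  set H : Multiset (Clause n) := ↑(List.ofFn A) with hH
  set X : Finset (PAssign n) := univ.filter (satAssign H) with hX
  have hcard : Nat.card {α : PAssign n // satAssign H α} = X.card := by
    rw [Nat.card_eq_fintype_card, Fintype.card_subtype]
  set D : Finset (Fin l → Clause n) := univ.filter fun B => theta H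
      (↑(List.ofFn B) : Multiset (Clause n)) < 2 / 3 with hD
  rcases X.eq_empty_or_nonempty with hX0 | hXne
  · have : ∀ B : Fin l → Clause n, theta H (↑(List.ofFn B) : Multiset (Clause n)) = 1 := by
      intro B
      rw [theta, if_pos (by rw [hcard, hX0, card_empty])]
    rw [pr_eq_card_filter]
    simp only [this]
    norm_num
    exact hε0
  have hXpos : (0 : ℝ) < X.card := by exact_mod_cast hXne.card_pos
  have hmany : ∀ B ∈ D, (X.card : ℝ) / 3 ≤
      ((X.filter fun α => ¬ extendable (↑(List.ofFn B) : Multiset (Clause n)) α).card : ℝ) := by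
    intro B hB
    have hB := (mem_filter.1 hB).2
    rw [theta, if_neg (by rw [hcard]; exact hXne.card_pos.ne'), hcard, div_lt_iff₀ hXpos,
      Nat.card_eq_fintype_card, Fintype.card_subtype, ← filter_filter] at hB
    have := card_filter_add_card_filter_not (s := X)
      (fun α => extendable (↑(List.ofFn B) : Multiset (Clause n)) α)
    rw [← hX] at hB
    have : ((X.filter fun α => extendable (↑(List.ofFn B) : Multiset (Clause n)) α).card : ℝ) +
      (X.filter fun α => ¬ extendable (↑(List.ofFn B) : Multiset (Clause n)) α).card = X.card := by
      exact_mod_cast this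
    linarith
  have hdouble : (D.card : ℝ) * (X.card / 3) ≤
      X.card * (ε * Fintype.card (Fin l → Clause n)) := by
    calc (D.card : ℝ) * (X.card / 3)
        = ∑ B ∈ D, (X.card : ℝ) / 3 := by rw [sum_const, nsmul_eq_mul]
      _ ≤ ∑ B ∈ D, ((X.filter fun α =>
            ¬ extendable (↑(List.ofFn B) : Multiset (Clause n)) α).card : ℝ) := sum_le_sum hmany
      _ ≤ ∑ B : Fin l → Clause n, ((X.filter fun α =>
            ¬ extendable (↑(List.ofFn B) : Multiset (Clause n)) α).card : ℝ) :=
          sum_le_sum_of_subset_of_nonneg (subset_univ _) (fun _ _ _ => by positivity)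
      _ = ∑ α ∈ X, ((univ.filter fun B : Fin l → Clause n =>
            ¬ extendable (↑(List.ofFn B) : Multiset (Clause n)) α).card : ℝ) := by
          exact_mod_cast sum_card_bipartiteAbove_eq_sum_card_bipartiteBelow
            (s := (univ : Finset (Fin l → Clause n))) (t := X)
            (fun B α => ¬ extendable (↑(List.ofFn B) : Multiset (Clause n)) α)
      _ ≤ ∑ _α ∈ X, ε * Fintype.card (Fin l → Clause n) := by
          refine sum_le_sum fun α hα => ?_
          have hα := (mem_filter.1 hα).2
          have := hε α (by rw [hα.1]; exact card_mvars_ofFn_le A)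
          rw [pr_eq_card_filter] at this
          rcases Nat.eq_zero_or_pos (Fintype.card (Fin l → Clause n)) with h0 | hpos
          · have : IsEmpty (Fin l → Clause n) := Fintype.card_eq_zero_iff.1 h0
            rw [univ_eq_empty]
            simp
          · rw [div_le_iff₀ (by exact_mod_cast hpos)] at this
            convert this
      _ = _ := by rw [sum_const, nsmul_eq_mul]
  have hDle : (D.card : ℝ) ≤ 3 * ε * Fintype.card (Fin l → Clause n) := by
    refine le_of_mul_le_mul_right (a := (X.card : ℝ) / 3) ?_ (by positivity)
    calc _ ≤ _ := hdouble
      _ = _ := by ring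
  rw [pr_eq_card_filter]
  exact div_le_of_le_mul₀ (by positivity) (by positivity) hDle

/-- A bound for every first component bounds the probability of an event on sequences. -/
theorem pr_append_le {Ω : Type*} [Fintype Ω] {k l : ℕ} {ε : ℝ} (hε0 : 0 ≤ ε)
    (P : (Fin (k + l) → Ω) → Prop)
    (h : ∀ A : Fin k → Ω, pr (Fin l → Ω) (fun B => P (Fin.append A B)) ≤ ε) :
    pr (Fin (k + l) → Ω) P ≤ ε := by
  have hle : ∀ A : Fin k → Ω, (Nat.card {B : Fin l → Ω // P (Fin.append A B)} : ℝ) ≤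
      ε * Fintype.card (Fin l → Ω) := by
    intro A
    have := h A
    rcases Nat.eq_zero_or_pos (Fintype.card (Fin l → Ω)) with h0 | hpos
    · have : IsEmpty (Fin l → Ω) := Fintype.card_eq_zero_iff.1 h0
      rw [Nat.card_of_isEmpty, h0]
      simp
    · rwa [pr, div_le_iff₀ (by exact_mod_cast hpos)] at this
  have hcard : Nat.card {C : Fin (k + l) → Ω // P C} =
      ∑ A : Fin k → Ω, Nat.card {B : Fin l → Ω // P (Fin.append A B)} := by
    rw [← Nat.card_sigma]
    refine Nat.card_congr (((Fin.appendEquiv k l).subtypeEquiv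
      (p := fun x => P (Fin.append x.1 x.2)) fun x => Iff.rfl).symm.trans
      (Equiv.subtypeProdEquivSigmaSubtype fun A B => P (Fin.append A B)))
  rw [pr, hcard]
  refine div_le_of_le_mul₀ (by positivity) hε0 ?_
  push_cast
  calc _ ≤ ∑ _A : Fin k → Ω, ε * Fintype.card (Fin l → Ω) := sum_le_sum fun A _ => hle A
    _ = _ := by
      rw [sum_const, nsmul_eq_mul, card_univ, ← Fintype.card_congr (Fin.appendEquiv k l),
        Fintype.card_prod]
      push_cast
      ring

theorem pr_theta_take_drop_lt_le {n k m : ℕ} {ε : ℝ} (hk : k ≤ m)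
    (hε : ∀ α : PAssign n, (support α).card ≤ 2 * k →
      pr (Fin (m - k) → Clause n)
        (fun B => ¬ extendable (↑(List.ofFn B) : Multiset (Clause n)) α) ≤ ε) :
    pr (Fin m → Clause n) (fun C => theta (↑((List.ofFn C).take k) : Multiset (Clause n))
      (↑((List.ofFn C).drop k) : Multiset (Clause n)) < 2 / 3) ≤ 3 * ε := by
  obtain ⟨l, rfl⟩ := Nat.exists_eq_add_of_le hk
  rw [Nat.add_sub_cancel_left] at hε
  have hε0 : 0 ≤ ε := (pr_nonneg _).trans (hε (fun _ => none) (by simp [support]))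
  refine pr_append_le (by positivity) _ fun A => ?_
  have := pr_theta_lt_le A hε
  simpa [List.ofFn_fin_append] using this

/-- For `1/2 ≤ δ < 1`, `k = ⌈n^{1/3}⌉` and `F = C_1 ∧ ⋯ ∧ C_{⌊δn⌋} ∼ 𝓗₂(n,⌊δn⌋)`:
the probability that `θ(F^{≤k}, F^{>k}) < 2/3` tends to `0`, where `F^{≤k}` is the
conjunction of the first `k` clauses and `F^{>k}` that of the remaining ones. -/
theorem theta_first_clauses (δ : ℝ) (h0 : 1 / 2 ≤ δ) (h1 : δ < 1) :
    Tendsto (fun n : ℕ =>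
      pr (Fin ⌊δ * n⌋₊ → Clause n)
        (fun C =>
          theta (↑((List.ofFn C).take ⌈(n : ℝ) ^ ((1 : ℝ) / 3)⌉₊) : Multiset (Clause n))
                (↑((List.ofFn C).drop ⌈(n : ℝ) ^ ((1 : ℝ) / 3)⌉₊) : Multiset (Clause n))
            < 2 / 3))
      atTop (nhds 0) := by
  set Q : ℝ := (1 + δ) / 2 with hQ
  have hQ0 : 0 ≤ Q := by rw [hQ]; linarith
  have hQ1 : Q < 1 := by rw [hQ]; linarith
  have hsum : Summable fun r : ℕ => ((r : ℝ) + 1) ^ 2 * Q ^ (r + 1) := by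
    have := summable_pow_mul_geometric_of_norm_lt_one (R := ℝ) 2 (r := Q)
      (by rwa [Real.norm_of_nonneg hQ0])
    simpa using (summable_nat_add_iff 1).2 this
  set K : ℝ := ∑' r : ℕ, ((r : ℝ) + 1) ^ 2 * Q ^ (r + 1) with hK
  have hKle : ∀ N : ℕ, ∑ r ∈ range N, ((r : ℝ) + 1) ^ 2 * Q ^ (r + 1) ≤ K := fun N =>
    hsum.sum_le_tsum _ fun r _ => by positivity
  have hK0 : 0 ≤ K := tsum_nonneg fun r => by positivity
  have hcbrt : Tendsto (fun n : ℕ => (n : ℝ) ^ ((1 : ℝ) / 3)) atTop atTop :=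
    (tendsto_rpow_atTop (by norm_num)).comp tendsto_natCast_atTop_atTop
  have hlim : Tendsto (fun n : ℕ => 3 * (4 * 49 * K) * ((n : ℝ) ^ ((1 : ℝ) / 3))⁻¹)
      atTop (nhds 0) := by
    simpa using hcbrt.inv_tendsto_atTop.const_mul (3 * (4 * 49 * K))
  refine squeeze_zero' (Eventually.of_forall fun n => pr_nonneg _) ?_ hlim
  filter_upwards [hcbrt.eventually_ge_atTop 3,
    tendsto_natCast_atTop_atTop.eventually_ge_atTop ((1 + δ) / (1 - δ)),
    eventually_ge_atTop 2] with n hn3 hnQ hn2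
  set c : ℝ := (n : ℝ) ^ ((1 : ℝ) / 3) with hc
  have hc3 : c ^ 3 = n := by
    rw [hc, ← Real.rpow_natCast, ← Real.rpow_mul (Nat.cast_nonneg n)]
    norm_num
  set k : ℕ := ⌈c⌉₊ with hk
  have hkc : (k : ℝ) < c + 1 := Nat.ceil_lt_add_one (by linarith)
  have hkm : k ≤ ⌊δ * n⌋₊ := by
    apply Nat.le_floor
    rw [← hc3]
    nlinarith [mul_nonneg (sub_nonneg.2 h0) (pow_nonneg (by linarith : 0 ≤ c) 3),
      mul_nonneg (sub_nonneg.2 hn3) (sub_nonneg.2 hn3), sq_nonneg c, sq_nonneg (c - 3),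
      mul_nonneg (mul_nonneg (sub_nonneg.2 hn3) (sub_nonneg.2 hn3)) (by linarith : 0 ≤ c)]
  have hfloor : (⌊δ * n⌋₊ : ℝ) ≤ δ * n := Nat.floor_le (by positivity)
  have hmQ : ((⌊δ * n⌋₊ - k : ℕ) : ℝ) ≤ Q * (n - 1) := by
    have h2 : ((⌊δ * n⌋₊ - k : ℕ) : ℝ) ≤ ⌊δ * n⌋₊ := by exact_mod_cast Nat.sub_le _ _
    rw [div_le_iff₀ (by linarith)] at hnQ
    rw [hQ]
    linarith
  have hbound := pr_theta_take_drop_lt_le (n := n) (ε := 4 * 49 * K * c⁻¹) hkm fun α hα => by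
    refine (pr_not_extendable_le hQ0 hQ1.le hKle hn2 hmQ α).trans ?_
    have hs : ((support α).card : ℝ) + 1 ≤ 7 * c := by
      have : ((support α).card : ℝ) ≤ 2 * k := by exact_mod_cast hα
      linarith
    have hcpos : 0 < c := by linarith
    calc 4 * (((support α).card : ℝ) + 1) ^ 2 / n * K ≤ 4 * (7 * c) ^ 2 / n * K := by gcongr
      _ = _ := by
        rw [← hc3]
        field_simp
        ring
  simpa only [mul_assoc] using hbound
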